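/- Let G be a 2-Sperner family of intervals in Z/nZ, and let I be the number of isolated members of G (members comparable under inclusion with no other member of G). If 1 ≤ I ≤ n−1, then |G| ≤ 2n − I − 1. -/

import Mathlib

/-- `Σ_I(n,k)` from the paper. -/
def SigmaI (n k : ℕ) : ℕ :=
  if n % 2 = 1 then
    ∑ i ∈ Finset.Icc ((n + 1) / 2) ((n + 1) / 2 + k - 1), Nat.choose n i
  else
    Nat.choose (n - 1) (n / 2 - 1) +
      ∑ i ∈ Finset.Icc (n / 2 + 1) (n / 2 + k - 1), Nat.choose n i +
      Nat.choose (n - 1) (n / 2 + k)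

/-- A family of finite sets is intersecting if any two members meet. -/
def Intersecting {α : Type*} [DecidableEq α] (F : Finset (Finset α)) : Prop :=
  ∀ A ∈ F, ∀ B ∈ F, (A ∩ B).Nonempty

/-- A family is butterfly-free if there are no four distinct members
`A,B,C,D` with `A ⊆ C`, `A ⊆ D`, `B ⊆ C`, `B ⊆ D`. -/
def ButterflyFree {α : Type*} (F : Finset (Finset α)) : Prop :=
  ¬ ∃ A B C D : Finset α, A ∈ F ∧ B ∈ F ∧ C ∈ F ∧ D ∈ F ∧
    A ≠ B ∧ A ≠ C ∧ A ≠ D ∧ B ≠ C ∧ B ≠ D ∧ C ≠ D ∧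
    A ⊆ C ∧ A ⊆ D ∧ B ⊆ C ∧ B ⊆ D

/-- A family is `k`-Sperner if it contains no chain of `k+1` distinct sets. -/
def KSperner {α : Type*} (k : ℕ) (F : Finset (Finset α)) : Prop :=
  ¬ ∃ c : Fin (k + 1) → Finset α, (∀ i, c i ∈ F) ∧ StrictMono c

/-- `S ⊆ ZMod n` is an interval if it is `{i, i+1, …, i+j-1}` for some
`i : ZMod n` and `1 ≤ j ≤ n`. -/
def IsInterval (n : ℕ) (S : Finset (ZMod n)) : Prop :=
  ∃ (i : ZMod n) (j : ℕ), 1 ≤ j ∧ j ≤ n ∧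
    S = (Finset.range j).image (fun t : ℕ => i + (t : ZMod n))

/-- The interval `A_i^j = {i, i+1, …, i+j-1}` in `ZMod n`. -/
def IntervalA (n : ℕ) (i : ZMod n) (j : ℕ) : Finset (ZMod n) :=
  (Finset.range j).image (fun t : ℕ => i + (t : ZMod n))

theorem KSperner.not_ssubset_ssubset {α : Type*} {G : Finset (Finset α)} (hG : KSperner 2 G)
    {A B C : Finset α} (hA : A ∈ G) (hB : B ∈ G) (hC : C ∈ G) (hAB : A ⊂ B) : ¬ B ⊂ C := by
  intro hBC
  refine hG ⟨![A, B, C], ?_, ?_⟩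
  · intro i
    fin_cases i <;> assumption
  · rw [Fin.strictMono_iff_lt_succ]
    intro i
    fin_cases i <;> assumption

theorem card_intervalA {n j : ℕ} (i : ZMod n) (hj : j ≤ n) : (IntervalA n i j).card = j := by
  rw [IntervalA, Finset.card_image_of_injOn, Finset.card_range]
  intro a ha b hb hab
  have ha' : a < n := (Finset.mem_range.1 ha).trans_le hj
  have hb' : b < n := (Finset.mem_range.1 hb).trans_le hj
  have h := (ZMod.natCast_eq_natCast_iff' a b n).1 (add_left_cancel hab)
  rwa [Nat.mod_eq_of_lt ha', Nat.mod_eq_of_lt hb'] at h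

theorem intervalA_mono {n j k : ℕ} (i : ZMod n) (h : j ≤ k) : IntervalA n i j ⊆ IntervalA n i k :=
  Finset.image_subset_image (Finset.range_mono h)

theorem intervalA_succ_subset {n j k : ℕ} (i : ZMod n) (h : j < k) :
    IntervalA n (i + 1) j ⊆ IntervalA n i k := by
  intro x hx
  obtain ⟨t, ht, rfl⟩ := Finset.mem_image.1 hx
  have := Finset.mem_range.1 ht
  refine Finset.mem_image.2 ⟨t + 1, Finset.mem_range.2 (by omega), ?_⟩
  push_cast
  ring

theorem IsInterval.exists_eq_intervalA_card {n : ℕ} {S : Finset (ZMod n)} (hS : IsInterval n S) :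
    ∃ i, S = IntervalA n i S.card := by
  obtain ⟨i, j, -, hj, h⟩ := hS
  change S = IntervalA n i j at h
  exact ⟨i, by rw [h, card_intervalA i hj]⟩

theorem ZMod.forall_of_add_one {n : ℕ} [NeZero n] {p : ZMod n → Prop} {i : ZMod n} (hi : p i)
    (h : ∀ j, p j → p (j + 1)) (j : ZMod n) : p j := by
  have key : ∀ k : ℕ, p (i + k) := by
    intro k
    induction k with
    | zero => simpa using hi
    | succ k ih =>
      have := h _ ih
      rwa [add_assoc, ← Nat.cast_succ] at this
  have := key (j - i).val
  rwa [ZMod.natCast_zmod_val, add_sub_cancel] at this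

theorem twoSperner_intervals_card_le_improved (n : ℕ) (hn : 0 < n)
    (G : Finset (Finset (ZMod n)))
    (hint : ∀ S ∈ G, IsInterval n S)
    (hS : KSperner 2 G)
    (I : ℕ)
    (hI : I = (G.filter (fun A => ∀ B ∈ G, B ≠ A → ¬ A ⊆ B ∧ ¬ B ⊆ A)).card)
    (hI1 : 1 ≤ I) (hI2 : I ≤ n - 1) :
    G.card ≤ 2 * n - I - 1 := by
  generalize hJ : G.filter (fun A => ∀ B ∈ G, B ≠ A → ¬ A ⊆ B ∧ ¬ B ⊆ A) = J at hI
  have hJG : ∀ A ∈ J, A ∈ G := fun A hA => (Finset.mem_filter.1 (hJ ▸ hA)).1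
  have hJ' : ∀ A ∈ J, ∀ B ∈ G, A ⊆ B ∨ B ⊆ A → B = A := by
    intro A hA B hB h
    by_contra hne
    rw [← hJ, Finset.mem_filter] at hA
    have := hA.2 B hB hne
    tauto
  have : NeZero n := ⟨hn.ne'⟩
  by_contra hlt
  have hstart : ∀ S, ∃ i, S ∈ G → S = IntervalA n i S.card := by
    intro S
    by_cases h : S ∈ G
    · obtain ⟨i, hi⟩ := (hint S h).exists_eq_intervalA_card
      exact ⟨i, fun _ => hi⟩
    · exact ⟨0, fun h' => absurd h' h⟩
  choose s hs using hstart
  have hsub : ∀ A ∈ G, ∀ B ∈ G, s A = s B → A.card ≤ B.card → A ⊆ B := by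
    intro A hA B hB h hc
    rw [hs A hA, hs B hB, h]
    exact intervalA_mono _ hc
  have hsub' : ∀ A ∈ G, ∀ B ∈ G, s A = s B + 1 → A.card < B.card → A ⊆ B := by
    intro A hA B hB h hc
    rw [hs A hA, hs B hB, h]
    exact intervalA_succ_subset _ hc
  have hcomp : ∀ A ∈ G, ∀ B ∈ G, s A = s B → A ⊆ B ∨ B ⊆ A := by
    intro A hA B hB h
    rcases le_total A.card B.card with hc | hc
    · exact Or.inl (hsub A hA B hB h hc)
    · exact Or.inr (hsub B hB A hA h.symm hc)
  have hlt_of_ne : ∀ A ∈ G, ∀ B ∈ G, s A = s B → A ≠ B → A ⊂ B ∨ B ⊂ A := by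
    intro A hA B hB h hne
    rcases hcomp A hA B hB h with hc | hc
    · exact Or.inl (hc.ssubset_of_ne hne)
    · exact Or.inr (hc.ssubset_of_ne hne.symm)
  have hfiber : ∀ i, (G.filter (s · = i)).card + (J.filter (s · = i)).card ≤ 2 := by
    intro i
    by_cases h : (J.filter (s · = i)).Nonempty
    · obtain ⟨A, hA⟩ := h
      obtain ⟨hA, hAi⟩ := Finset.mem_filter.1 hA
      have hG1 : G.filter (s · = i) ⊆ {A} := by
        intro B hB
        obtain ⟨hB, hBi⟩ := Finset.mem_filter.1 hB
        exact Finset.mem_singleton.2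
          (hJ' A hA B hB (hcomp A (hJG A hA) B hB (hAi.trans hBi.symm)))
      have h1 := Finset.card_le_card hG1
      have h2 := Finset.card_le_card
        (Finset.filter_subset_filter (s · = i) hJG)
      rw [Finset.card_singleton] at h1
      omega
    · rw [Finset.not_nonempty_iff_eq_empty.1 h, Finset.card_empty, add_zero]
      by_contra hc
      obtain ⟨A, B, C, hA, hB, hC, hAB, hAC, hBC⟩ := Finset.two_lt_card_iff.1 (not_le.1 hc)
      obtain ⟨hA, hAi⟩ := Finset.mem_filter.1 hA
      obtain ⟨hB, hBi⟩ := Finset.mem_filter.1 hB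
      obtain ⟨hC, hCi⟩ := Finset.mem_filter.1 hC
      have h1 := hlt_of_ne A hA B hB (hAi.trans hBi.symm) hAB
      have h2 := hlt_of_ne A hA C hC (hAi.trans hCi.symm) hAC
      have h3 := hlt_of_ne B hB C hC (hBi.trans hCi.symm) hBC
      have hno : ∀ X ∈ G, ∀ Y ∈ G, ∀ Z ∈ G, X ⊂ Y → ¬ Y ⊂ Z :=
        fun X hX Y hY Z hZ => hS.not_ssubset_ssubset hX hY hZ
      rcases h1 with h1 | h1 <;> rcases h2 with h2 | h2 <;> rcases h3 with h3 | h3 <;>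
        first
        | exact hno _ ‹_› _ ‹_› _ ‹_› h1 h2
        | exact hno _ ‹_› _ ‹_› _ ‹_› h1 h3
        | exact hno _ ‹_› _ ‹_› _ ‹_› h2 h1
        | exact hno _ ‹_› _ ‹_› _ ‹_› h2 h3
        | exact hno _ ‹_› _ ‹_› _ ‹_› h3 h1
        | exact hno _ ‹_› _ ‹_› _ ‹_› h3 h2
  have hsum : ∑ i, ((G.filter (s · = i)).card + (J.filter (s · = i)).card) = G.card + J.card := by
    rw [Finset.sum_add_distrib, ← Finset.card_eq_sum_card_fiberwise (fun _ _ => Finset.mem_univ _),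
      ← Finset.card_eq_sum_card_fiberwise (fun _ _ => Finset.mem_univ _)]
  have hconst : ∑ _i : ZMod n, 2 = 2 * n := by
    rw [Finset.sum_const, Finset.card_univ, ZMod.card, smul_eq_mul, mul_comm]
  have htight : ∀ i, (G.filter (s · = i)).card + (J.filter (s · = i)).card = 2 := by
    have h1 := Finset.sum_le_sum (fun i (_ : i ∈ Finset.univ) => hfiber i)
    have h2 := (Finset.sum_eq_sum_iff_of_le
      (fun i (_ : i ∈ Finset.univ) => hfiber i)).1 (by omega)
    exact fun i => h2 i (Finset.mem_univ i)
  have htop : ∀ i, ∃ U ∈ G, s U = i ∧ (U ∈ J ∨ ∃ L ∈ G, s L = i ∧ L ⊂ U) := by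
    intro i
    by_cases h : (J.filter (s · = i)).Nonempty
    · obtain ⟨A, hA⟩ := h
      obtain ⟨hA, hAi⟩ := Finset.mem_filter.1 hA
      exact ⟨A, hJG A hA, hAi, Or.inl hA⟩
    · have h2 := htight i
      rw [Finset.not_nonempty_iff_eq_empty.1 h, Finset.card_empty, add_zero] at h2
      obtain ⟨A, B, hA, hB, hAB⟩ := Finset.one_lt_card_iff.1 (h2.symm ▸ one_lt_two)
      obtain ⟨hA, hAi⟩ := Finset.mem_filter.1 hA
      obtain ⟨hB, hBi⟩ := Finset.mem_filter.1 hB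
      rcases hlt_of_ne A hA B hB (hAi.trans hBi.symm) hAB with hc | hc
      · exact ⟨B, hB, hBi, Or.inr ⟨A, hA, hAi, hc⟩⟩
      · exact ⟨A, hA, hAi, Or.inr ⟨B, hB, hBi, hc⟩⟩
  choose U hUG hUs hU using htop
  have hmono : ∀ i, (U i).card ≤ (U (i + 1)).card := by
    intro i
    by_contra hc
    rw [not_le] at hc
    have hss : U (i + 1) ⊂ U i :=
      (hsub' _ (hUG _) _ (hUG _) (by rw [hUs, hUs]) hc).ssubset_of_ne (fun h => by simp [h] at hc)
    rcases hU (i + 1) with h | ⟨L, hL, -, hLU⟩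
    · exact hss.ne (hJ' _ h _ (hUG i) (Or.inl hss.subset)).symm
    · exact hS.not_ssubset_ssubset hL (hUG _) (hUG _) hLU hss
  have hcard : ∀ i j, (U i).card ≤ (U j).card := fun i =>
    ZMod.forall_of_add_one (p := fun j => (U i).card ≤ (U j).card) le_rfl
      (fun j hj => hj.trans (hmono j))
  obtain ⟨A, hA⟩ := Finset.card_pos.1 (show 0 < J.card by omega)
  have hUA : U (s A) = A :=
    hJ' A hA _ (hUG _) (hcomp A (hJG A hA) _ (hUG _) (hUs _).symm)
  have hall : ∀ i, U i ∈ J := by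
    refine ZMod.forall_of_add_one (i := s A) (hUA.symm ▸ hA) (fun i hi => ?_)
    refine (hU (i + 1)).resolve_right ?_
    rintro ⟨L, hL, hLs, hLU⟩
    have hc : L.card < (U i).card := (Finset.card_lt_card hLU).trans_le (hcard _ _)
    have hLi : L = U i :=
      hJ' _ hi L hL (Or.inr (hsub' L hL _ (hUG i) (by rw [hLs, hUs]) hc))
    exact hc.ne (congrArg Finset.card hLi)
  have hn_le : Fintype.card (ZMod n) ≤ J.card :=
    Finset.card_le_card_of_injOn U (fun i _ => hall i)
      (fun i _ j _ h => by rw [← hUs i, ← hUs j]; exact congrArg s h)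
  rw [ZMod.card] at hn_le
  omega
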